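/- Let d = 3 and γ ∈ (0, 3/2). There exists a constant C > 0 such that for all N ≥ 1, every l ∈ ℤ³₀, and all unit vectors a, b ∈ ℝ³ orthogonal to l with either a = b or a·b = 0, one has |∑_{k ∈ ℤ³₀, k ≠ l} (θ^N_k)² sin²(∠_{k,l}) (a·(k−l))(b·(k−l))/|k−l|² − (4/15)·δ| ≤ C D_N |l|, where δ = 1 if a = b and δ = 0 if a·b = 0. -/

import Mathlib

/-- Euclidean norm of a lattice point `k ∈ ℤ^d`. -/
noncomputable def znorm {d : ℕ} (k : Fin d → ℤ) : ℝ :=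
  Real.sqrt (∑ i, ((k i : ℝ)) ^ 2)

/-- Euclidean inner product of two lattice points. -/
noncomputable def zdot {d : ℕ} (k l : Fin d → ℤ) : ℝ :=
  ∑ i, (k i : ℝ) * (l i : ℝ)

/-- Inner product of a real vector with a lattice point. -/
noncomputable def rdot {d : ℕ} (a : Fin d → ℝ) (k : Fin d → ℤ) : ℝ :=
  ∑ i, a i * (k i : ℝ)

/-- `sin²(∠_{k,l}) = 1 - (k·l)²/(|k|²|l|²)`. -/
noncomputable def sin2 {d : ℕ} (k l : Fin d → ℤ) : ℝ :=
  1 - zdot k l ^ 2 / (znorm k ^ 2 * znorm l ^ 2)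

/-- `ε_N = (∑_{k ∈ ℤ^d₀, |k| ≤ N} |k|^{-2γ})⁻¹`. -/
noncomputable def epsN (d : ℕ) (γ : ℝ) (N : ℕ) : ℝ :=
  (∑' k : Fin d → ℤ, if k ≠ 0 ∧ znorm k ≤ N then znorm k ^ (-(2 : ℝ) * γ) else 0)⁻¹

/-- `θ^N_k = √ε_N |k|^{-γ} 1_{1 ≤ |k| ≤ N}`. -/
noncomputable def thetaN (d : ℕ) (γ : ℝ) (N : ℕ) (k : Fin d → ℤ) : ℝ :=
  if 1 ≤ znorm k ∧ znorm k ≤ N then Real.sqrt (epsN d γ N) * znorm k ^ (-γ) else 0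

/-- `D_N = ε_N ∑_{k ∈ ℤ^d₀, |k| ≤ N} |k|^{-2γ-1}`. -/
noncomputable def DN (d : ℕ) (γ : ℝ) (N : ℕ) : ℝ :=
  epsN d γ N *
    ∑' k : Fin d → ℤ, if k ≠ 0 ∧ znorm k ≤ N then znorm k ^ (-(2 : ℝ) * γ - 1) else 0

open MeasureTheory Metric

/-- The quartic form `(|x|² - (e·x)²)(a·x)(b·x) - c|x|⁴` on Euclidean space. -/
noncomputable def quartic (e a b : EuclideanSpace ℝ (Fin 3)) (c : ℝ)
    (x : EuclideanSpace ℝ (Fin 3)) : ℝ :=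
  (‖x‖ ^ 2 - inner ℝ e x ^ 2) * (inner ℝ a x * inner ℝ b x) - c * ‖x‖ ^ 4

theorem continuous_quartic (e a b : EuclideanSpace ℝ (Fin 3)) (c : ℝ) :
    Continuous (quartic e a b c) := by
  unfold quartic
  fun_prop

theorem quartic_smul (e a b : EuclideanSpace ℝ (Fin 3)) (c t : ℝ)
    (x : EuclideanSpace ℝ (Fin 3)) :
    quartic e a b c (t • x) = t ^ 4 * quartic e a b c x := by
  simp only [quartic, norm_smul, inner_smul_right, mul_pow, Real.norm_eq_abs, sq_abs]
  have : |t| ^ 4 = t ^ 4 := by rw [show (4 : ℕ) = 2 * 2 from rfl, pow_mul, sq_abs, ← pow_mul]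
  rw [this]
  ring

/-- Integral of a function over a centred ball against a radial weight. -/
noncomputable def radialIntegral (w : ℝ → ℝ) (R : ℝ) (f : EuclideanSpace ℝ (Fin 3) → ℝ) : ℝ :=
  ∫ x in closedBall (0 : EuclideanSpace ℝ (Fin 3)) R, w ‖x‖ * f x

theorem integrableOn_radial {w : ℝ → ℝ} (hw : Continuous w) (R : ℝ)
    {f : EuclideanSpace ℝ (Fin 3) → ℝ} (hf : Continuous f) :
    IntegrableOn (fun x => w ‖x‖ * f x) (closedBall (0 : EuclideanSpace ℝ (Fin 3)) R) :=
  ContinuousOn.integrableOn_compact (isCompact_closedBall 0 R)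
    (Continuous.continuousOn (by fun_prop))

theorem radialIntegral_add {w : ℝ → ℝ} (hw : Continuous w) (R : ℝ)
    {f g : EuclideanSpace ℝ (Fin 3) → ℝ} (hf : Continuous f) (hg : Continuous g) :
    radialIntegral w R (fun x => f x + g x) = radialIntegral w R f + radialIntegral w R g := by
  unfold radialIntegral
  rw [← integral_add (integrableOn_radial hw R hf) (integrableOn_radial hw R hg)]
  simp only [mul_add]

theorem radialIntegral_const_mul (w : ℝ → ℝ) (R c : ℝ) (f : EuclideanSpace ℝ (Fin 3) → ℝ) :
    radialIntegral w R (fun x => c * f x) = c * radialIntegral w R f := by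
  unfold radialIntegral
  rw [← integral_const_mul]
  congr 1
  ext x
  ring

theorem radialIntegral_comp (w : ℝ → ℝ) (R : ℝ) (f : EuclideanSpace ℝ (Fin 3) → ℝ)
    (T : EuclideanSpace ℝ (Fin 3) ≃ₗᵢ[ℝ] EuclideanSpace ℝ (Fin 3)) :
    radialIntegral w R (fun x => f (T x)) = radialIntegral w R f := by
  have h := T.measurePreserving.setIntegral_preimage_emb
    T.toHomeomorph.measurableEmbedding (fun x => w ‖x‖ * f x) (closedBall 0 R)
  have h' : T ⁻¹' closedBall 0 R = closedBall 0 R := by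
    ext x
    simp
  rw [h'] at h
  simpa [radialIntegral] using h

/-- Radial integrals of zonal functions do not depend on the direction of the axis. -/
theorem radialIntegral_zonal_eq (w : ℝ → ℝ) (R : ℝ) (φ : ℝ → ℝ → ℝ)
    {u v : EuclideanSpace ℝ (Fin 3)} (h : ‖u‖ = ‖v‖) :
    radialIntegral w R (fun x => φ ‖x‖ (inner ℝ u x)) =
      radialIntegral w R (fun x => φ ‖x‖ (inner ℝ v x)) := by
  set T := (Submodule.span ℝ {u - v})ᗮ.reflection with hT
  have hu : T u = v := Submodule.reflection_sub h
  rw [← radialIntegral_comp w R (fun x => φ ‖x‖ (inner ℝ v x)) T]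
  congr 1
  ext x
  rw [← hu, T.inner_map_map, T.norm_map]

theorem radialIntegral_mixed {w : ℝ → ℝ} (hw : Continuous w) (R : ℝ)
    {u v : EuclideanSpace ℝ (Fin 3)} (h : ‖u‖ = ‖v‖) (huv : inner ℝ u v = 0) :
    3 * radialIntegral w R (fun x => inner ℝ u x ^ 2 * inner ℝ v x ^ 2) =
      radialIntegral w R (fun x => inner ℝ u x ^ 4) := by
  have hvu : inner ℝ v u = 0 := by rw [real_inner_comm, huv]
  have hsq : ‖u + v‖ ^ 2 = 2 * ‖u‖ ^ 2 := by
    rw [norm_add_sq_real, huv, h]; ring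
  have hsq' : ‖u - v‖ ^ 2 = 2 * ‖u‖ ^ 2 := by
    rw [norm_sub_sq_real, huv, h]; ring
  have hroot : ‖Real.sqrt 2 • u‖ ^ 2 = 2 * ‖u‖ ^ 2 := by
    rw [norm_smul, mul_pow, Real.norm_eq_abs, sq_abs, Real.sq_sqrt (by norm_num)]
  have e1 : ‖u + v‖ = ‖Real.sqrt 2 • u‖ :=
    (sq_eq_sq₀ (norm_nonneg _) (norm_nonneg _)).1 (hsq.trans hroot.symm)
  have e2 : ‖u - v‖ = ‖Real.sqrt 2 • u‖ :=
    (sq_eq_sq₀ (norm_nonneg _) (norm_nonneg _)).1 (hsq'.trans hroot.symm)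
  have i1 := radialIntegral_zonal_eq w R (fun _ t => t ^ 4) e1
  have i2 := radialIntegral_zonal_eq w R (fun _ t => t ^ 4) e2
  have i3 := radialIntegral_zonal_eq w R (fun _ t => t ^ 4) h
  have i4 : radialIntegral w R (fun x => inner ℝ (Real.sqrt 2 • u) x ^ 4) =
      4 * radialIntegral w R (fun x => inner ℝ u x ^ 4) := by
    rw [← radialIntegral_const_mul]
    congr 1
    ext x
    rw [real_inner_smul_left, mul_pow, show (4 : ℕ) = 2 * 2 from rfl, pow_mul (Real.sqrt 2),
      Real.sq_sqrt (by norm_num)]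
    norm_num
  have i5 : radialIntegral w R (fun x => inner ℝ (u + v) x ^ 4 + inner ℝ (u - v) x ^ 4) =
      radialIntegral w R (fun x => (2 * inner ℝ u x ^ 4 + 2 * inner ℝ v x ^ 4) +
        12 * (inner ℝ u x ^ 2 * inner ℝ v x ^ 2)) := by
    congr 1
    ext x
    rw [inner_add_left, inner_sub_left]
    ring
  rw [radialIntegral_add hw R (by fun_prop) (by fun_prop),
    radialIntegral_add hw R (by fun_prop) (by fun_prop),
    radialIntegral_add hw R (by fun_prop) (by fun_prop),
    radialIntegral_const_mul, radialIntegral_const_mul, radialIntegral_const_mul] at i5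
  linarith

theorem norm_sq_eq_sum_inner_single (x : EuclideanSpace ℝ (Fin 3)) :
    ‖x‖ ^ 2 = inner ℝ (EuclideanSpace.single 0 1) x ^ 2 +
      inner ℝ (EuclideanSpace.single 1 1) x ^ 2 + inner ℝ (EuclideanSpace.single 2 1) x ^ 2 := by
  simp [EuclideanSpace.norm_sq_eq, Fin.sum_univ_three, EuclideanSpace.inner_single_left]

theorem radialIntegral_norm_sq_mul {w : ℝ → ℝ} (hw : Continuous w) (R : ℝ)
    {u : EuclideanSpace ℝ (Fin 3)} (hu : ‖u‖ = 1) :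
    radialIntegral w R (fun x => ‖x‖ ^ 2 * inner ℝ u x ^ 2) =
      5 / 3 * radialIntegral w R (fun x => inner ℝ u x ^ 4) := by
  set e : Fin 3 → EuclideanSpace ℝ (Fin 3) := fun i => EuclideanSpace.single i 1 with he
  have hn : ∀ i, ‖e i‖ = 1 := fun i => by simp [he]
  have ho : ∀ i j, i ≠ j → inner ℝ (e i) (e j) = 0 := fun i j hij => by
    simp [he, EuclideanSpace.inner_single_left, hij]
  have i1 := radialIntegral_zonal_eq w R (fun r t => r ^ 2 * t ^ 2) (hu.trans (hn 0).symm)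
  have i2 := radialIntegral_zonal_eq w R (fun _ t => t ^ 4) (hu.trans (hn 0).symm)
  have m1 := radialIntegral_mixed hw R ((hn 0).trans (hn 1).symm) (ho 0 1 (by decide))
  have m2 := radialIntegral_mixed hw R ((hn 0).trans (hn 2).symm) (ho 0 2 (by decide))
  have i3 : radialIntegral w R (fun x => ‖x‖ ^ 2 * inner ℝ (e 0) x ^ 2) =
      radialIntegral w R (fun x => inner ℝ (e 0) x ^ 4 +
        (inner ℝ (e 0) x ^ 2 * inner ℝ (e 1) x ^ 2 +
          inner ℝ (e 0) x ^ 2 * inner ℝ (e 2) x ^ 2)) := by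
    congr 1
    ext x
    rw [norm_sq_eq_sum_inner_single]
    ring
  rw [radialIntegral_add hw R (by fun_prop) (by fun_prop),
    radialIntegral_add hw R (by fun_prop) (by fun_prop)] at i3
  linarith

theorem radialIntegral_norm_pow_four {w : ℝ → ℝ} (hw : Continuous w) (R : ℝ)
    {u : EuclideanSpace ℝ (Fin 3)} (hu : ‖u‖ = 1) :
    radialIntegral w R (fun x => ‖x‖ ^ 4) =
      5 * radialIntegral w R (fun x => inner ℝ u x ^ 4) := by
  set e : Fin 3 → EuclideanSpace ℝ (Fin 3) := fun i => EuclideanSpace.single i 1 with he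
  have hn : ∀ i, ‖u‖ = ‖e i‖ := fun i => by simp [he, hu]
  have i1 := fun i => radialIntegral_zonal_eq w R (fun r t => r ^ 2 * t ^ 2) (hn i)
  have i2 := radialIntegral_norm_sq_mul hw R hu
  have i3 : radialIntegral w R (fun x => ‖x‖ ^ 4) =
      radialIntegral w R (fun x => ‖x‖ ^ 2 * inner ℝ (e 0) x ^ 2 +
        (‖x‖ ^ 2 * inner ℝ (e 1) x ^ 2 + ‖x‖ ^ 2 * inner ℝ (e 2) x ^ 2)) := by
    congr 1
    ext x
    rw [← mul_add, ← mul_add, ← add_assoc, he, ← norm_sq_eq_sum_inner_single]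
    ring
  rw [radialIntegral_add hw R (by fun_prop) (by fun_prop),
    radialIntegral_add hw R (by fun_prop) (by fun_prop)] at i3
  have j0 := i1 0
  have j1 := i1 1
  have j2 := i1 2
  linarith

theorem radialIntegral_quartic_self {w : ℝ → ℝ} (hw : Continuous w) (R : ℝ)
    {e a : EuclideanSpace ℝ (Fin 3)} (he : ‖e‖ = 1) (ha : ‖a‖ = 1) (hea : inner ℝ e a = 0) :
    radialIntegral w R (quartic e a a (4 / 15)) = 0 := by
  have m1 := radialIntegral_mixed hw R (he.trans ha.symm) hea
  have m2 := radialIntegral_norm_sq_mul hw R ha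
  have m3 := radialIntegral_norm_pow_four hw R ha
  have m4 := radialIntegral_zonal_eq w R (fun _ t => t ^ 4) (he.trans ha.symm)
  have i3 : radialIntegral w R (quartic e a a (4 / 15)) =
      radialIntegral w R (fun x => ‖x‖ ^ 2 * inner ℝ a x ^ 2 +
        (-1 * (inner ℝ e x ^ 2 * inner ℝ a x ^ 2) + -(4 / 15) * ‖x‖ ^ 4)) := by
    congr 1
    ext x
    rw [quartic]
    ring
  rw [radialIntegral_add hw R (by fun_prop) (by fun_prop),
    radialIntegral_add hw R (by fun_prop) (by fun_prop),
    radialIntegral_const_mul, radialIntegral_const_mul] at i3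
  linarith

theorem radialIntegral_quartic_of_orthogonal (w : ℝ → ℝ) (R : ℝ)
    {e a b : EuclideanSpace ℝ (Fin 3)} (hea : inner ℝ e a = 0) (hab : inner ℝ a b = 0) :
    radialIntegral w R (quartic e a b 0) = 0 := by
  set T := (Submodule.span ℝ {a})ᗮ.reflection with hT
  have ha : T a = -a := Submodule.reflection_orthogonalComplement_singleton_eq_neg a
  have he : T e = e := Submodule.reflection_mem_subspace_eq_self
    (Submodule.mem_orthogonal_singleton_iff_inner_left.2 hea)
  have hb : T b = b := Submodule.reflection_mem_subspace_eq_self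
    (Submodule.mem_orthogonal_singleton_iff_inner_right.2 hab)
  have h := radialIntegral_comp w R (quartic e a b 0) T
  have h' : (fun x => quartic e a b 0 (T x)) = fun x => -1 * quartic e a b 0 x := by
    ext x
    have h1 : inner ℝ e (T x) = inner ℝ e x := by
      conv_lhs => rw [← he]
      exact T.inner_map_map e x
    have h2 : inner ℝ b (T x) = inner ℝ b x := by
      conv_lhs => rw [← hb]
      exact T.inner_map_map b x
    have h3 : inner ℝ a (T x) = -inner ℝ a x := by
      have := T.inner_map_map a x
      rw [ha, inner_neg_left] at this
      linarith
    simp only [quartic, h1, h2, h3, T.norm_map]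
    ring
  rw [h', radialIntegral_const_mul] at h
  linarith

theorem rpow_neg_sub_rpow_neg_le {p A B : ℝ} (hp : 0 ≤ p) (hA : 0 < A) (hAB : A ≤ B) :
    A ^ (-p) - B ^ (-p) ≤ p * (B - A) * A ^ (-p - 1) := by
  have hr : 0 < B / A := div_pos (hA.trans_le hAB) hA
  have h1 : B ^ (-p) = A ^ (-p) * (B / A) ^ (-p) := by
    rw [← Real.mul_rpow hA.le hr.le, mul_div_cancel₀ _ hA.ne']
  have h2 : 1 - p * (B / A - 1) ≤ (B / A) ^ (-p) := by
    rw [Real.rpow_def_of_pos hr]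
    have h3 := Real.add_one_le_exp (Real.log (B / A) * -p)
    have h4 := mul_le_mul_of_nonneg_left (Real.log_le_sub_one_of_pos hr) hp
    linarith
  have h5 : A ^ (-p - 1) = A ^ (-p) / A := Real.rpow_sub_one hA.ne' _
  have h6 := mul_le_mul_of_nonneg_left h2 (Real.rpow_nonneg hA.le (-p))
  have h7 : p * (B - A) * A ^ (-p - 1) = A ^ (-p) * (p * (B / A - 1)) := by
    rw [h5]
    field_simp
  rw [h1, h7]
  linarith

theorem abs_rpow_neg_sub_rpow_neg_le {p A B : ℝ} (hp : 0 ≤ p) (hA : 0 < A) (hB : 0 < B)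
    (h : B ≤ 3 * A) :
    |A ^ (-p) - B ^ (-p)| ≤ 3 ^ (p + 1) * p * |A - B| * B ^ (-p - 1) := by
  have h3 : (1 : ℝ) ≤ 3 ^ (p + 1) := Real.one_le_rpow (by norm_num) (by linarith)
  have hBp : 0 ≤ B ^ (-p - 1) := Real.rpow_nonneg hB.le _
  rcases le_total A B with hAB | hAB
  · have hmono : B ^ (-p) ≤ A ^ (-p) := Real.rpow_le_rpow_of_nonpos hA hAB (by linarith)
    rw [abs_of_nonneg (sub_nonneg.2 hmono), abs_of_nonpos (sub_nonpos.2 hAB)]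
    refine (rpow_neg_sub_rpow_neg_le hp hA hAB).trans ?_
    have h4 : A ^ (-p - 1) ≤ 3 ^ (p + 1) * B ^ (-p - 1) := by
      have h5 : A ^ (-p - 1) ≤ (B / 3) ^ (-p - 1) :=
        Real.rpow_le_rpow_of_nonpos (by positivity) (by linarith) (by linarith)
      rw [Real.div_rpow hB.le (by norm_num), show -p - 1 = -(p + 1) by ring,
        Real.rpow_neg (by norm_num : (0 : ℝ) ≤ 3), div_inv_eq_mul] at h5
      rw [show -p - 1 = -(p + 1) by ring]
      linarith
    have h6 := mul_le_mul_of_nonneg_left h4 (mul_nonneg hp (sub_nonneg.2 hAB))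
    linarith
  · have hmono : A ^ (-p) ≤ B ^ (-p) := Real.rpow_le_rpow_of_nonpos hB hAB (by linarith)
    rw [abs_of_nonpos (sub_nonpos.2 hmono), abs_of_nonneg (sub_nonneg.2 hAB)]
    have h4 := rpow_neg_sub_rpow_neg_le hp hB hAB
    have h5 : 0 ≤ p * (A - B) * B ^ (-p - 1) :=
      mul_nonneg (mul_nonneg hp (sub_nonneg.2 hAB)) hBp
    nlinarith

theorem abs_mul_sub_mul_le_add {x y x' y' s t : ℝ} (hy : |y| ≤ 1) (hx' : |x'| ≤ 1)
    (hs : |x - x'| ≤ s) (ht : |y - y'| ≤ t) : |x * y - x' * y'| ≤ s + t := by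
  have h : x * y - x' * y' = (x - x') * y + x' * (y - y') := by ring
  rw [h]
  refine (abs_add_le _ _).trans (add_le_add ?_ ?_)
  · rw [abs_mul]
    exact (mul_le_of_le_one_right (abs_nonneg _) hy).trans hs
  · rw [abs_mul]
    exact (mul_le_of_le_one_left (abs_nonneg _) hx').trans ht

theorem abs_inner_le_norm_of_norm_eq_one {a : EuclideanSpace ℝ (Fin 3)} (ha : ‖a‖ = 1)
    (x : EuclideanSpace ℝ (Fin 3)) : |inner ℝ a x| ≤ ‖x‖ := by
  simpa [ha] using abs_real_inner_le_norm a x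

theorem abs_norm_sq_sub_inner_sq_le_one {e u : EuclideanSpace ℝ (Fin 3)} (he : ‖e‖ = 1)
    (hu : ‖u‖ ≤ 1) : |‖u‖ ^ 2 - inner ℝ e u ^ 2| ≤ 1 := by
  have h1 := sq_le_sq' (by linarith [norm_nonneg u, neg_abs_le (inner ℝ e u),
    abs_inner_le_norm_of_norm_eq_one he u]) ((le_abs_self _).trans
      (abs_inner_le_norm_of_norm_eq_one he u))
  have h2 : ‖u‖ ^ 2 ≤ 1 := pow_le_one₀ (norm_nonneg _) hu
  rw [abs_le]
  constructor <;> nlinarith [sq_nonneg (inner ℝ e u)]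

theorem abs_quartic_le {e a b u : EuclideanSpace ℝ (Fin 3)} {c : ℝ} (he : ‖e‖ = 1)
    (ha : ‖a‖ = 1) (hb : ‖b‖ = 1) (hc : |c| ≤ 1) (hu : ‖u‖ ≤ 1) :
    |quartic e a b c u| ≤ 2 := by
  have h1 := abs_norm_sq_sub_inner_sq_le_one he hu
  have h2 := (abs_inner_le_norm_of_norm_eq_one ha u).trans hu
  have h3 := (abs_inner_le_norm_of_norm_eq_one hb u).trans hu
  have h4 : |‖u‖ ^ 4| ≤ 1 := by
    rw [abs_of_nonneg (by positivity)]
    exact pow_le_one₀ (norm_nonneg _) hu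
  have h5 : |(‖u‖ ^ 2 - inner ℝ e u ^ 2) * (inner ℝ a u * inner ℝ b u)| ≤ 1 := by
    rw [abs_mul, abs_mul]
    exact mul_le_one₀ h1 (by positivity) (mul_le_one₀ h2 (abs_nonneg _) h3)
  have h6 : |c * ‖u‖ ^ 4| ≤ 1 := by
    rw [abs_mul]
    exact mul_le_one₀ hc (abs_nonneg _) h4
  exact (abs_sub _ _).trans (by linarith)

theorem abs_quartic_sub_le {e a b u v : EuclideanSpace ℝ (Fin 3)} {c : ℝ} (he : ‖e‖ = 1)
    (ha : ‖a‖ = 1) (hb : ‖b‖ = 1) (hc : |c| ≤ 1) (hu : ‖u‖ ≤ 1) (hv : ‖v‖ ≤ 1) :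
    |quartic e a b c u - quartic e a b c v| ≤ 10 * ‖u - v‖ := by
  have inner_le : ∀ {w : EuclideanSpace ℝ (Fin 3)}, ‖w‖ = 1 →
      |inner ℝ w u - inner ℝ w v| ≤ ‖u - v‖ := fun hw => by
    rw [← inner_sub_right]
    exact abs_inner_le_norm_of_norm_eq_one hw _
  have le_one : ∀ {w z : EuclideanSpace ℝ (Fin 3)}, ‖w‖ = 1 → ‖z‖ ≤ 1 →
      |inner ℝ w z| ≤ 1 := fun hw hz => (abs_inner_le_norm_of_norm_eq_one hw _).trans hz
  have hnu : |‖u‖| ≤ 1 := by rwa [abs_norm]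
  have hnv : |‖v‖| ≤ 1 := by rwa [abs_norm]
  have n1 : |‖u‖ - ‖v‖| ≤ ‖u - v‖ := abs_norm_sub_norm_le u v
  have n2 := abs_mul_sub_mul_le_add hnu hnv n1 n1
  have n2u : |‖u‖ * ‖u‖| ≤ 1 := by rw [abs_mul]; exact mul_le_one₀ hnu (abs_nonneg _) hnu
  have n2v : |‖v‖ * ‖v‖| ≤ 1 := by rw [abs_mul]; exact mul_le_one₀ hnv (abs_nonneg _) hnv
  have n4 := abs_mul_sub_mul_le_add n2u n2v n2 n2
  have i2 := abs_mul_sub_mul_le_add (le_one he hu) (le_one he hv) (inner_le he) (inner_le he)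
  have p2 := abs_mul_sub_mul_le_add (le_one hb hu) (le_one ha hv) (inner_le ha) (inner_le hb)
  have hpu : |inner ℝ a u * inner ℝ b u| ≤ 1 := by
    rw [abs_mul]
    exact mul_le_one₀ (le_one ha hu) (abs_nonneg _) (le_one hb hu)
  have q2 : |(‖u‖ ^ 2 - inner ℝ e u ^ 2) - (‖v‖ ^ 2 - inner ℝ e v ^ 2)| ≤ 4 * ‖u - v‖ := by
    have h : (‖u‖ ^ 2 - inner ℝ e u ^ 2) - (‖v‖ ^ 2 - inner ℝ e v ^ 2) =
        (‖u‖ * ‖u‖ - ‖v‖ * ‖v‖) - (inner ℝ e u * inner ℝ e u - inner ℝ e v * inner ℝ e v) := by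
      ring
    rw [h]
    exact (abs_sub _ _).trans (by linarith)
  have q4 := abs_mul_sub_mul_le_add hpu (abs_norm_sq_sub_inner_sq_le_one he hv) q2 p2
  have r4 : |c * (‖u‖ * ‖u‖ * (‖u‖ * ‖u‖) - ‖v‖ * ‖v‖ * (‖v‖ * ‖v‖))| ≤ 4 * ‖u - v‖ := by
    rw [abs_mul]
    exact (mul_le_of_le_one_left (abs_nonneg _) hc).trans (by linarith)
  have h : quartic e a b c u - quartic e a b c v =
      ((‖u‖ ^ 2 - inner ℝ e u ^ 2) * (inner ℝ a u * inner ℝ b u) -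
        (‖v‖ ^ 2 - inner ℝ e v ^ 2) * (inner ℝ a v * inner ℝ b v)) -
      c * (‖u‖ * ‖u‖ * (‖u‖ * ‖u‖) - ‖v‖ * ‖v‖ * (‖v‖ * ‖v‖)) := by
    unfold quartic
    ring
  rw [h]
  exact (abs_sub _ _).trans (by linarith)

/-- The norm truncated from below at `1`. -/
noncomputable def truncNorm (x : EuclideanSpace ℝ (Fin 3)) : ℝ := max ‖x‖ 1

theorem one_le_truncNorm (x : EuclideanSpace ℝ (Fin 3)) : 1 ≤ truncNorm x := le_max_right _ _

theorem norm_le_truncNorm (x : EuclideanSpace ℝ (Fin 3)) : ‖x‖ ≤ truncNorm x := le_max_left _ _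

theorem truncNorm_pos (x : EuclideanSpace ℝ (Fin 3)) : 0 < truncNorm x :=
  one_pos.trans_le (one_le_truncNorm x)

theorem abs_truncNorm_sub_le (x y : EuclideanSpace ℝ (Fin 3)) :
    |truncNorm x - truncNorm y| ≤ ‖x - y‖ :=
  (abs_max_sub_max_le_abs _ _ _).trans (abs_norm_sub_norm_le x y)

theorem truncNorm_le_three_mul {x y : EuclideanSpace ℝ (Fin 3)} (h : ‖x - y‖ ≤ 2) :
    truncNorm x ≤ 3 * truncNorm y := by
  have := (abs_le.1 (abs_truncNorm_sub_le x y)).2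
  linarith [one_le_truncNorm y]

theorem norm_inv_truncNorm_smul_le (x : EuclideanSpace ℝ (Fin 3)) :
    ‖(truncNorm x)⁻¹ • x‖ ≤ 1 := by
  rw [norm_smul, norm_inv, Real.norm_eq_abs, abs_of_pos (truncNorm_pos x), inv_mul_eq_div]
  exact (div_le_one (truncNorm_pos x)).2 (norm_le_truncNorm x)

theorem norm_inv_truncNorm_smul_sub_le (x y : EuclideanSpace ℝ (Fin 3)) :
    ‖(truncNorm x)⁻¹ • x - (truncNorm y)⁻¹ • y‖ ≤ 2 * ‖x - y‖ / truncNorm y := by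
  have hx := truncNorm_pos x
  have hy := truncNorm_pos y
  have h : (truncNorm x)⁻¹ • x - (truncNorm y)⁻¹ • y =
      (truncNorm y)⁻¹ • (x - y) +
        ((truncNorm y)⁻¹ * (truncNorm y - truncNorm x)) • ((truncNorm x)⁻¹ • x) := by
    rw [smul_smul, smul_sub, sub_add_eq_add_sub, ← add_smul]
    congr 2
    field_simp
    ring
  rw [h]
  refine (norm_add_le _ _).trans ?_
  have h1 : ‖(truncNorm y)⁻¹ • (x - y)‖ = ‖x - y‖ / truncNorm y := by
    rw [norm_smul, norm_inv, Real.norm_eq_abs, abs_of_pos hy, inv_mul_eq_div]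
  have h2 : ‖((truncNorm y)⁻¹ * (truncNorm y - truncNorm x)) • ((truncNorm x)⁻¹ • x)‖ ≤
      ‖x - y‖ / truncNorm y := by
    rw [norm_smul, norm_mul, norm_inv, Real.norm_eq_abs, abs_of_pos hy, inv_mul_eq_div]
    refine (mul_le_of_le_one_right (by positivity) (norm_inv_truncNorm_smul_le x)).trans ?_
    gcongr
    rw [Real.norm_eq_abs, abs_sub_comm]
    exact abs_truncNorm_sub_le x y
  rw [h1]
  calc _ ≤ ‖x - y‖ / truncNorm y + ‖x - y‖ / truncNorm y := by gcongr
    _ = _ := by ring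

/-- The quartic form on the truncated direction of `x`, weighted by a power of the truncated
norm. -/
noncomputable def weightedQuartic (p : ℝ) (e a b : EuclideanSpace ℝ (Fin 3)) (c : ℝ)
    (x : EuclideanSpace ℝ (Fin 3)) : ℝ :=
  truncNorm x ^ (-p) * quartic e a b c ((truncNorm x)⁻¹ • x)

section WeightedQuartic

variable {p c : ℝ} {e a b : EuclideanSpace ℝ (Fin 3)}

theorem abs_weightedQuartic_le (he : ‖e‖ = 1) (ha : ‖a‖ = 1) (hb : ‖b‖ = 1) (hc : |c| ≤ 1)
    (x : EuclideanSpace ℝ (Fin 3)) :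
    |weightedQuartic p e a b c x| ≤ 2 * truncNorm x ^ (-p) := by
  have h := abs_quartic_le he ha hb hc (norm_inv_truncNorm_smul_le x)
  have h0 : 0 ≤ truncNorm x ^ (-p) := Real.rpow_nonneg (truncNorm_pos x).le _
  rw [weightedQuartic, abs_mul, abs_of_nonneg h0, mul_comm 2]
  gcongr

theorem abs_weightedQuartic_sub_le (hp : 0 ≤ p) (he : ‖e‖ = 1) (ha : ‖a‖ = 1) (hb : ‖b‖ = 1)
    (hc : |c| ≤ 1) {x y : EuclideanSpace ℝ (Fin 3)} (h : ‖x - y‖ ≤ 2) :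
    |weightedQuartic p e a b c x - weightedQuartic p e a b c y| ≤
      (3 ^ (p + 1) * p * 4 + 40) * truncNorm y ^ (-p - 1) := by
  have hx := truncNorm_pos x
  have hy := truncNorm_pos y
  have hyx : truncNorm y ≤ 3 * truncNorm x :=
    truncNorm_le_three_mul (by rwa [norm_sub_rev])
  have h1 := abs_rpow_neg_sub_rpow_neg_le hp hx hy hyx
  have h2 := abs_quartic_le he ha hb hc (norm_inv_truncNorm_smul_le x)
  have h3 := (abs_quartic_sub_le he ha hb hc (norm_inv_truncNorm_smul_le x)
    (norm_inv_truncNorm_smul_le y)).trans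
      (mul_le_mul_of_nonneg_left (norm_inv_truncNorm_smul_sub_le x y) (by norm_num))
  have h4 : (0 : ℝ) ≤ 3 ^ (p + 1) * p := by positivity
  have h5 : 0 ≤ truncNorm y ^ (-p - 1) := Real.rpow_nonneg hy.le _
  have h6 : truncNorm y ^ (-p - 1) = truncNorm y ^ (-p) / truncNorm y :=
    Real.rpow_sub_one hy.ne' _
  have h7 : 0 ≤ truncNorm y ^ (-p) := Real.rpow_nonneg hy.le _
  have key : weightedQuartic p e a b c x - weightedQuartic p e a b c y =
      (truncNorm x ^ (-p) - truncNorm y ^ (-p)) * quartic e a b c ((truncNorm x)⁻¹ • x) +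
      truncNorm y ^ (-p) * (quartic e a b c ((truncNorm x)⁻¹ • x) -
        quartic e a b c ((truncNorm y)⁻¹ • y)) := by
    unfold weightedQuartic
    ring
  have b1 : |truncNorm x ^ (-p) - truncNorm y ^ (-p)| ≤
      3 ^ (p + 1) * p * 2 * truncNorm y ^ (-p - 1) := by
    refine h1.trans ?_
    gcongr
    exact (abs_truncNorm_sub_le x y).trans h
  have b2 : |quartic e a b c ((truncNorm x)⁻¹ • x) - quartic e a b c ((truncNorm y)⁻¹ • y)| ≤
      40 / truncNorm y := by
    refine h3.trans ?_
    rw [mul_div_assoc']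
    gcongr
    linarith
  rw [key]
  refine (abs_add_le _ _).trans ?_
  rw [abs_mul, abs_mul, abs_of_nonneg h7]
  calc _ ≤ 3 ^ (p + 1) * p * 2 * truncNorm y ^ (-p - 1) * 2 +
        truncNorm y ^ (-p) * (40 / truncNorm y) := by gcongr
    _ = _ := by rw [h6]; ring

theorem setIntegral_weightedQuartic (R : ℝ)
    (h : ∀ w : ℝ → ℝ, Continuous w → radialIntegral w R (quartic e a b c) = 0) :
    IntegrableOn (weightedQuartic p e a b c) (closedBall 0 R) ∧
      ∫ x in closedBall 0 R, weightedQuartic p e a b c x = 0 := by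
  set w : ℝ → ℝ := fun r => max r 1 ^ (-p) * (max r 1)⁻¹ ^ 4 with hw
  have hpos : ∀ r : ℝ, max r 1 ≠ 0 := fun r => (one_pos.trans_le (le_max_right r 1)).ne'
  have hmax : Continuous fun r : ℝ => max r 1 := by fun_prop
  have hwc : Continuous w :=
    (hmax.rpow_const fun r => Or.inl (hpos r)).mul ((hmax.inv₀ hpos).pow 4)
  have heq : weightedQuartic p e a b c = fun x => w ‖x‖ * quartic e a b c x := by
    ext x
    rw [weightedQuartic, quartic_smul, hw, truncNorm]
    ring
  rw [heq]
  exact ⟨integrableOn_radial hwc R (continuous_quartic e a b c), h w hwc⟩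

end WeightedQuartic

/-- A lattice point seen as a point of Euclidean space. -/
noncomputable def latticePoint (k : Fin 3 → ℤ) : EuclideanSpace ℝ (Fin 3) :=
  WithLp.toLp 2 fun i => (k i : ℝ)

theorem norm_latticePoint (k : Fin 3 → ℤ) : ‖latticePoint k‖ = znorm k := by
  simp [latticePoint, znorm, EuclideanSpace.norm_eq]

/-- The coordinatewise integer part. -/
noncomputable def floorPoint (x : EuclideanSpace ℝ (Fin 3)) : Fin 3 → ℤ := fun i => ⌊x i⌋

theorem norm_sub_latticePoint_floorPoint_le (x : EuclideanSpace ℝ (Fin 3)) :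
    ‖x - latticePoint (floorPoint x)‖ ≤ 2 := by
  rw [EuclideanSpace.norm_eq]
  refine Real.sqrt_le_iff.2 ⟨by norm_num, ?_⟩
  have h : ∀ i, ‖(x - latticePoint (floorPoint x)) i‖ ^ 2 ≤ 1 := fun i => by
    have h1 : (x - latticePoint (floorPoint x)) i = Int.fract (x i) := rfl
    rw [h1, Real.norm_eq_abs, sq_abs]
    exact pow_le_one₀ (Int.fract_nonneg _) (Int.fract_lt_one _).le
  refine (Finset.sum_le_sum fun i _ => h i).trans ?_
  norm_num

theorem floorPoint_preimage_singleton (k : Fin 3 → ℤ) :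
    floorPoint ⁻¹' {k} =
      WithLp.ofLp ⁻¹' (Set.univ.pi fun i => Set.Ico (k i : ℝ) ((k i : ℝ) + 1)) := by
  ext x
  simp [floorPoint, funext_iff, Int.floor_eq_iff]

theorem measurableSet_floorPoint_preimage_singleton (k : Fin 3 → ℤ) :
    MeasurableSet (floorPoint ⁻¹' {k}) := by
  rw [floorPoint_preimage_singleton]
  exact (PiLp.volume_preserving_ofLp (Fin 3)).measurable
    (MeasurableSet.univ_pi fun _ => measurableSet_Ico)

theorem volume_floorPoint_preimage_singleton (k : Fin 3 → ℤ) :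
    volume (floorPoint ⁻¹' {k}) = 1 := by
  rw [floorPoint_preimage_singleton,
    (PiLp.volume_preserving_ofLp (Fin 3)).measure_preimage
      (MeasurableSet.univ_pi fun _ => measurableSet_Ico).nullMeasurableSet,
    Real.volume_pi_Ico]
  simp

/-- A finitely supported lattice sum is the integral of its extension to the unit cubes. -/
theorem integrable_comp_floorPoint {h : (Fin 3 → ℤ) → ℝ} {K : Finset (Fin 3 → ℤ)}
    (hK : ∀ k ∉ K, h k = 0) :
    Integrable (fun x => h (floorPoint x)) ∧ ∫ x, h (floorPoint x) = ∑ k ∈ K, h k := by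
  have heq : (fun x => h (floorPoint x)) =
      fun x => ∑ k ∈ K, (floorPoint ⁻¹' {k}).indicator (fun _ => h k) x := by
    ext x
    by_cases hx : floorPoint x ∈ K
    · rw [Finset.sum_eq_single_of_mem _ hx]
      · simp
      · intro k _ hk
        exact Set.indicator_of_notMem (fun h' => hk h'.symm) _
    · rw [hK _ hx, Finset.sum_eq_zero]
      intro k hk
      exact Set.indicator_of_notMem (fun h' => hx (by rwa [show floorPoint x = k from h'])) _
  have hint : ∀ k ∈ K, Integrable ((floorPoint ⁻¹' {k}).indicator fun _ => h k) := fun k _ =>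
    (integrable_indicator_iff (measurableSet_floorPoint_preimage_singleton k)).2
      (integrableOn_const (by simp [volume_floorPoint_preimage_singleton]))
  rw [heq]
  refine ⟨integrable_finsetSum _ hint, ?_⟩
  rw [integral_finsetSum _ hint]
  refine Finset.sum_congr rfl fun k _ => ?_
  rw [integral_indicator_const _ (measurableSet_floorPoint_preimage_singleton k), measureReal_def,
    volume_floorPoint_preimage_singleton]
  simp

open Classical in
/-- The lattice points of norm at most `N`. -/
noncomputable def latticeBall (N : ℕ) : Finset (Fin 3 → ℤ) :=
  (Fintype.piFinset fun _ => Finset.Icc (-(N : ℤ)) N).filter fun k => znorm k ≤ N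

theorem abs_le_znorm (k : Fin 3 → ℤ) (i : Fin 3) : |(k i : ℝ)| ≤ znorm k := by
  refine Real.abs_le_sqrt ?_
  exact Finset.single_le_sum (f := fun i => (k i : ℝ) ^ 2) (fun j _ => sq_nonneg _)
    (Finset.mem_univ i)

theorem mem_latticeBall {N : ℕ} {k : Fin 3 → ℤ} : k ∈ latticeBall N ↔ znorm k ≤ N := by
  classical
  rw [latticeBall, Finset.mem_filter, Fintype.mem_piFinset, and_iff_right_iff_imp]
  intro h i
  have h1 := abs_le.1 ((abs_le_znorm k i).trans h)
  rw [Finset.mem_Icc]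
  exact ⟨by exact_mod_cast h1.1, by exact_mod_cast h1.2⟩

theorem pow_three_le_card_latticeBall (N : ℕ) : N ^ 3 ≤ (latticeBall N).card := by
  have hsub : (Fintype.piFinset fun _ : Fin 3 => Finset.Icc (-((N / 2 : ℕ) : ℤ)) (N / 2 : ℕ)) ⊆
      latticeBall N := by
    intro k hk
    rw [Fintype.mem_piFinset] at hk
    rw [mem_latticeBall, znorm]
    refine Real.sqrt_le_iff.2 ⟨by positivity, ?_⟩
    have hN : ((N / 2 : ℕ) : ℝ) ≤ N / 2 := Nat.cast_div_le
    have h : ∀ i, (k i : ℝ) ^ 2 ≤ (N / 2 : ℝ) ^ 2 := fun i => by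
      have h1 := Finset.mem_Icc.1 (hk i)
      have h2 : (-((N / 2 : ℕ) : ℝ)) ≤ k i := by exact_mod_cast h1.1
      have h3 : (k i : ℝ) ≤ ((N / 2 : ℕ) : ℝ) :=
        ((Int.cast_le (R := ℝ)).2 h1.2).trans_eq (Int.cast_natCast _)
      exact sq_le_sq' (by linarith) (by linarith)
    rw [Fin.sum_univ_three]
    nlinarith [h 0, h 1, h 2, sq_nonneg (N : ℝ)]
  refine le_trans ?_ (Finset.card_le_card hsub)
  rw [Fintype.card_piFinset, Finset.prod_const, Finset.card_univ, Fintype.card_fin, Int.card_Icc]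
  refine Nat.pow_le_pow_left ?_ 3
  omega

theorem rpow_le_sum_latticeBall {N : ℕ} (hN : 1 ≤ N) {p : ℝ} (hp : 0 ≤ p) :
    (N : ℝ) ^ (-p) * (N : ℝ) ^ 2 ≤
      ∑ k ∈ latticeBall N, truncNorm (latticePoint k) ^ (-p - 1) := by
  have hN' : (1 : ℝ) ≤ N := by exact_mod_cast hN
  have hN0 : (0 : ℝ) < N := by linarith
  have h : ∀ k ∈ latticeBall N, (N : ℝ) ^ (-p - 1) ≤ truncNorm (latticePoint k) ^ (-p - 1) :=
    fun k hk => by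
      refine Real.rpow_le_rpow_of_nonpos (truncNorm_pos _) ?_ (by linarith)
      rw [truncNorm, norm_latticePoint]
      exact max_le (mem_latticeBall.1 hk) hN'
  have h1 := Finset.card_nsmul_le_sum _ _ _ h
  refine le_trans ?_ h1
  have h2 : ((N : ℝ) ^ 3) ≤ (latticeBall N).card := by
    exact_mod_cast pow_three_le_card_latticeBall N
  rw [nsmul_eq_mul, Real.rpow_sub_one hN0.ne']
  calc (N : ℝ) ^ (-p) * (N : ℝ) ^ 2 = (N : ℝ) ^ 3 * ((N : ℝ) ^ (-p) / N) := by
        field_simp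
    _ ≤ _ := by gcongr

/-- The boundary layer of the centred ball of radius `N`. -/
def ballShell (N : ℝ) : Set (EuclideanSpace ℝ (Fin 3)) :=
  closedBall 0 (N + 2) \ ball 0 (max (N - 2) 0)

theorem mem_ballShell {N : ℝ} {x : EuclideanSpace ℝ (Fin 3)} (h1 : N - 2 ≤ ‖x‖)
    (h2 : ‖x‖ ≤ N + 2) : x ∈ ballShell N := by
  simp [ballShell, h1, h2]

theorem measurableSet_ballShell (N : ℝ) : MeasurableSet (ballShell N) :=
  measurableSet_closedBall.diff measurableSet_ball

theorem volume_real_ballShell_le {N : ℝ} (hN : 1 ≤ N) :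
    volume.real (ballShell N) ≤
      28 * volume.real (ball (0 : EuclideanSpace ℝ (Fin 3)) 1) * N ^ 2 := by
  have hsub : ball (0 : EuclideanSpace ℝ (Fin 3)) (max (N - 2) 0) ⊆ closedBall 0 (N + 2) :=
    ball_subset_closedBall.trans (closedBall_subset_closedBall (max_le (by linarith) (by linarith)))
  rw [ballShell, measureReal_sdiff hsub measurableSet_ball measure_closedBall_lt_top.ne,
    Measure.addHaar_real_closedBall _ _ (by linarith),
    ← Measure.addHaar_real_closedBall_eq_addHaar_real_ball _ _ (max (N - 2) 0),
    Measure.addHaar_real_closedBall _ _ (le_max_right _ _), finrank_euclideanSpace_fin, ← sub_mul]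
  have hV : 0 ≤ volume.real (ball (0 : EuclideanSpace ℝ (Fin 3)) 1) := measureReal_nonneg
  have h : (N + 2) ^ 3 - max (N - 2) 0 ^ 3 ≤ 28 * N ^ 2 := by
    rcases le_total (N - 2) 0 with h | h
    · rw [max_eq_right h]
      nlinarith
    · rw [max_eq_left h]
      nlinarith
  nlinarith

theorem integrable_indicator_ballShell (N t : ℝ) :
    Integrable ((ballShell N).indicator fun _ => t) := by
  refine (integrable_indicator_iff (measurableSet_ballShell N)).2 (integrableOn_const ?_)
  exact ((measure_mono Set.sdiff_subset).trans_lt measure_closedBall_lt_top).ne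

theorem abs_weightedQuartic_le_of_lt {p c : ℝ} {e a b : EuclideanSpace ℝ (Fin 3)} (hp : 0 ≤ p)
    (he : ‖e‖ = 1) (ha : ‖a‖ = 1) (hb : ‖b‖ = 1) (hc : |c| ≤ 1) {N : ℝ} (hN : 0 < N)
    {x y : EuclideanSpace ℝ (Fin 3)} (hxy : ‖x - y‖ ≤ 2) (hx : N < ‖x‖) :
    |weightedQuartic p e a b c y| ≤ 2 * 3 ^ p * N ^ (-p) := by
  refine (abs_weightedQuartic_le he ha hb hc y).trans ?_
  have h1 : N / 3 ≤ truncNorm y := by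
    linarith [truncNorm_le_three_mul hxy, norm_le_truncNorm x]
  have h2 : truncNorm y ^ (-p) ≤ (N / 3) ^ (-p) :=
    Real.rpow_le_rpow_of_nonpos (by positivity) h1 (by linarith)
  rw [Real.div_rpow hN.le (by norm_num), Real.rpow_neg (by norm_num : (0 : ℝ) ≤ 3),
    div_inv_eq_mul] at h2
  linarith

open Classical in
theorem abs_cutoff_sub_cutoff_le {p c : ℝ} {e a b : EuclideanSpace ℝ (Fin 3)} (hp : 0 ≤ p)
    (he : ‖e‖ = 1) (ha : ‖a‖ = 1) (hb : ‖b‖ = 1) (hc : |c| ≤ 1) {N : ℝ} (hN : 0 < N)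
    {x y : EuclideanSpace ℝ (Fin 3)} (hxy : ‖x - y‖ ≤ 2) :
    |(if ‖y‖ ≤ N then weightedQuartic p e a b c y else 0) -
        (closedBall 0 N).indicator (weightedQuartic p e a b c) x| ≤
      (3 ^ (p + 1) * p * 4 + 40) * (if ‖y‖ ≤ N then truncNorm y ^ (-p - 1) else 0) +
        (ballShell N).indicator (fun _ => 2 * 3 ^ p * N ^ (-p)) x := by
  have htri := abs_le.1 ((abs_norm_sub_norm_le x y).trans hxy)
  have hyx : ‖y - x‖ ≤ 2 := by rwa [norm_sub_rev]
  have hshell : 0 ≤ (ballShell N).indicator (fun _ => 2 * 3 ^ p * N ^ (-p)) x :=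
    Set.indicator_nonneg (fun _ _ => by positivity) _
  have hpow : 0 ≤ truncNorm y ^ (-p - 1) := Real.rpow_nonneg (truncNorm_pos y).le _
  by_cases hy : ‖y‖ ≤ N <;> by_cases hx : ‖x‖ ≤ N
  · rw [if_pos hy, if_pos hy, Set.indicator_of_mem (by simpa using hx), abs_sub_comm]
    linarith [abs_weightedQuartic_sub_le hp he ha hb hc hxy]
  · rw [if_pos hy, if_pos hy, Set.indicator_of_notMem (by simpa using hx), sub_zero,
      Set.indicator_of_mem (mem_ballShell (by linarith) (by linarith))]
    have := abs_weightedQuartic_le_of_lt hp he ha hb hc hN hxy (not_le.1 hx)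
    have : 0 ≤ (3 ^ (p + 1) * p * 4 + 40) * truncNorm y ^ (-p - 1) := by positivity
    linarith
  · rw [if_neg hy, if_neg hy, Set.indicator_of_mem (by simpa using hx), zero_sub, abs_neg,
      Set.indicator_of_mem (mem_ballShell (by linarith) (by linarith))]
    have := abs_weightedQuartic_le_of_lt hp he ha hb hc hN hyx (not_le.1 hy)
    linarith
  · rw [if_neg hy, if_neg hy, Set.indicator_of_notMem (by simpa using hx)]
    simpa using hshell

open Classical in
/-- Lattice sums of mean-zero quartic forms are controlled by the sum with one more power of
decay. -/
theorem exists_abs_sum_weightedQuartic_le {p : ℝ} (hp : 0 ≤ p) :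
    ∃ C : ℝ, 0 < C ∧ ∀ N : ℕ, 1 ≤ N → ∀ (e a b : EuclideanSpace ℝ (Fin 3)) (c : ℝ),
      ‖e‖ = 1 → ‖a‖ = 1 → ‖b‖ = 1 → |c| ≤ 1 →
      (∀ w : ℝ → ℝ, Continuous w → radialIntegral w N (quartic e a b c) = 0) →
      |∑ k ∈ latticeBall N, weightedQuartic p e a b c (latticePoint k)| ≤
        C * ∑ k ∈ latticeBall N, truncNorm (latticePoint k) ^ (-p - 1) := by
  set V := volume.real (ball (0 : EuclideanSpace ℝ (Fin 3)) 1) with hV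
  have hV0 : 0 ≤ V := measureReal_nonneg
  set L : ℝ := 3 ^ (p + 1) * p * 4 + 40 with hL
  have hL0 : 0 < L := by positivity
  refine ⟨L + 2 * 3 ^ p * (28 * V), by positivity, ?_⟩
  intro N hN e a b c he ha hb hc hrad
  have hN' : (1 : ℝ) ≤ N := by exact_mod_cast hN
  have hN0 : (0 : ℝ) < N := by linarith
  set h : (Fin 3 → ℤ) → ℝ := fun k =>
    if ‖latticePoint k‖ ≤ N then weightedQuartic p e a b c (latticePoint k) else 0 with hh
  set h' : (Fin 3 → ℤ) → ℝ := fun k =>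
    if ‖latticePoint k‖ ≤ N then truncNorm (latticePoint k) ^ (-p - 1) else 0 with hh'
  have mem_iff : ∀ k, k ∈ latticeBall N ↔ ‖latticePoint k‖ ≤ N := fun k => by
    rw [mem_latticeBall, norm_latticePoint]
  obtain ⟨i1, s1⟩ := integrable_comp_floorPoint (h := h) (K := latticeBall N)
    fun k hk => if_neg fun hk' => hk ((mem_iff k).2 hk')
  obtain ⟨i2, s2⟩ := integrable_comp_floorPoint (h := h') (K := latticeBall N)
    fun k hk => if_neg fun hk' => hk ((mem_iff k).2 hk')
  have t1 : ∑ k ∈ latticeBall N, h k =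
      ∑ k ∈ latticeBall N, weightedQuartic p e a b c (latticePoint k) :=
    Finset.sum_congr rfl fun k hk => if_pos ((mem_iff k).1 hk)
  have t2 : ∑ k ∈ latticeBall N, h' k =
      ∑ k ∈ latticeBall N, truncNorm (latticePoint k) ^ (-p - 1) :=
    Finset.sum_congr rfl fun k hk => if_pos ((mem_iff k).1 hk)
  obtain ⟨i3, s3⟩ := setIntegral_weightedQuartic (p := p) (N : ℝ) hrad
  rw [← integrable_indicator_iff measurableSet_closedBall] at i3
  rw [← integral_indicator measurableSet_closedBall] at s3
  have i4 := integrable_indicator_ballShell N (2 * 3 ^ p * (N : ℝ) ^ (-p))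
  have hbound := norm_integral_le_of_norm_le ((i2.const_mul L).add i4)
    (f := fun x => h (floorPoint x) -
      (closedBall 0 (N : ℝ)).indicator (weightedQuartic p e a b c) x)
    (Filter.Eventually.of_forall fun x => by
      rw [Real.norm_eq_abs]
      exact abs_cutoff_sub_cutoff_le hp he ha hb hc hN0
        (norm_sub_latticePoint_floorPoint_le x))
  rw [integral_sub i1 i3, s3, sub_zero, s1, t1, Real.norm_eq_abs] at hbound
  refine hbound.trans ?_
  have hsplit := integral_add (i2.const_mul L) i4
  rw [integral_const_mul, s2, t2, integral_indicator_const _ (measurableSet_ballShell _)] at hsplit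
  refine hsplit.le.trans ?_
  rw [add_mul L, smul_eq_mul]
  refine add_le_add le_rfl ?_
  calc volume.real (ballShell N) * (2 * 3 ^ p * (N : ℝ) ^ (-p))
      ≤ 28 * V * (N : ℝ) ^ 2 * (2 * 3 ^ p * (N : ℝ) ^ (-p)) := by
        gcongr
        exact volume_real_ballShell_le hN'
    _ = 2 * 3 ^ p * (28 * V) * ((N : ℝ) ^ (-p) * (N : ℝ) ^ 2) := by ring
    _ ≤ _ := by
        gcongr
        exact rpow_le_sum_latticeBall hN hp

theorem inner_toLp_latticePoint (a : Fin 3 → ℝ) (k : Fin 3 → ℤ) :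
    inner ℝ (WithLp.toLp 2 a) (latticePoint k) = rdot a k := by
  simp [PiLp.inner_apply, latticePoint, rdot, mul_comm]

theorem inner_latticePoint_latticePoint (k l : Fin 3 → ℤ) :
    inner ℝ (latticePoint k) (latticePoint l) = zdot k l := by
  simp [PiLp.inner_apply, latticePoint, zdot, mul_comm]

theorem latticePoint_sub (k l : Fin 3 → ℤ) :
    latticePoint (k - l) = latticePoint k - latticePoint l := by
  ext i
  simp [latticePoint]

theorem rdot_sub (a : Fin 3 → ℝ) (k l : Fin 3 → ℤ) :
    rdot a (k - l) = rdot a k - rdot a l := by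
  rw [← inner_toLp_latticePoint, latticePoint_sub, inner_sub_right, inner_toLp_latticePoint,
    inner_toLp_latticePoint]

theorem one_le_znorm {k : Fin 3 → ℤ} (hk : k ≠ 0) : 1 ≤ znorm k := by
  obtain ⟨i, hi⟩ := Function.ne_iff.1 hk
  refine le_trans ?_ (abs_le_znorm k i)
  exact_mod_cast Int.one_le_abs hi

theorem znorm_single : znorm (Pi.single 0 1 : Fin 3 → ℤ) = 1 := by
  simp [znorm, Fin.sum_univ_three]

theorem abs_rdot_le {a : Fin 3 → ℝ} (ha : ∑ i, a i ^ 2 = 1) (k : Fin 3 → ℤ) :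
    |rdot a k| ≤ znorm k := by
  rw [← inner_toLp_latticePoint, ← norm_latticePoint]
  exact abs_inner_le_norm_of_norm_eq_one (by simp [EuclideanSpace.norm_eq, ha]) _

theorem truncNorm_latticePoint {k : Fin 3 → ℤ} (hk : k ≠ 0) :
    truncNorm (latticePoint k) = znorm k := by
  rw [truncNorm, norm_latticePoint, max_eq_left (one_le_znorm hk)]

theorem latticePoint_zero : latticePoint 0 = 0 := by
  ext i
  simp [latticePoint]

theorem truncNorm_latticePoint_zero : truncNorm (latticePoint 0) = 1 := by
  simp [latticePoint_zero, truncNorm]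

theorem weightedQuartic_latticePoint_zero (p : ℝ) (e a b : EuclideanSpace ℝ (Fin 3)) (c : ℝ) :
    weightedQuartic p e a b c (latticePoint 0) = 0 := by
  simp [latticePoint_zero, weightedQuartic, quartic]

theorem sin2_eq (k l : Fin 3 → ℤ) (hk : k ≠ 0) :
    sin2 k l = ‖(znorm k)⁻¹ • latticePoint k‖ ^ 2 -
      inner ℝ ((znorm l)⁻¹ • latticePoint l) ((znorm k)⁻¹ • latticePoint k) ^ 2 := by
  have hk0 : znorm k ≠ 0 := (one_pos.trans_le (one_le_znorm hk)).ne'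
  rw [norm_smul, norm_inv, Real.norm_eq_abs, mul_pow, inv_pow, sq_abs, norm_latticePoint,
    inv_mul_cancel₀ (pow_ne_zero 2 hk0), real_inner_smul_left, real_inner_smul_right,
    real_inner_comm, inner_latticePoint_latticePoint, sin2]
  field_simp

theorem abs_sin2_le_one {k l : Fin 3 → ℤ} (hk : k ≠ 0) (hl : l ≠ 0) : |sin2 k l| ≤ 1 := by
  have unit : ∀ {m : Fin 3 → ℤ}, m ≠ 0 → ‖(znorm m)⁻¹ • latticePoint m‖ = 1 := fun hm => by
    have hm1 := one_le_znorm hm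
    rw [norm_smul, norm_latticePoint, norm_inv, Real.norm_eq_abs,
      abs_of_pos (by linarith), inv_mul_cancel₀ (by linarith)]
  rw [sin2_eq k l hk]
  exact abs_norm_sq_sub_inner_sq_le_one (unit hl) (unit hk).le

theorem weightedQuartic_latticePoint {p c : ℝ} {k l : Fin 3 → ℤ} {a b : Fin 3 → ℝ}
    (hk : k ≠ 0) :
    weightedQuartic p ((znorm l)⁻¹ • latticePoint l) (WithLp.toLp 2 a) (WithLp.toLp 2 b) c
        (latticePoint k) =
      znorm k ^ (-p) * (sin2 k l * (rdot a k * rdot b k / znorm k ^ 2) - c) := by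
  have hk0 : 0 < znorm k := one_pos.trans_le (one_le_znorm hk)
  have hn : ‖(znorm k)⁻¹ • latticePoint k‖ = 1 := by
    rw [norm_smul, norm_latticePoint, norm_inv, Real.norm_eq_abs,
      abs_of_pos hk0, inv_mul_cancel₀ hk0.ne']
  rw [weightedQuartic, truncNorm_latticePoint hk, quartic, ← sin2_eq k l hk, hn,
    real_inner_smul_right, real_inner_smul_right, inner_toLp_latticePoint,
    inner_toLp_latticePoint]
  field_simp

theorem abs_div_sq_sub_div_sq_le {α β x y L : ℝ} (hx : 0 < x) (hy : 0 ≤ y) (hL : |x - y| ≤ L)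
    (hαx : |α| ≤ x) (hαy : |α| ≤ y) (hβx : |β| ≤ x) (hβy : |β| ≤ y) :
    |α * β / y ^ 2 - α * β / x ^ 2| ≤ 2 * L / x := by
  have hL0 : 0 ≤ L := (abs_nonneg _).trans hL
  rcases hy.eq_or_lt with rfl | hy
  · have : α = 0 := abs_nonpos_iff.1 hαy
    subst this
    simp only [zero_mul, zero_div, sub_zero, abs_zero]
    positivity
  have h : α * β / y ^ 2 - α * β / x ^ 2 =
      (α * β) * ((x - y) * (x + y)) / (x ^ 2 * y ^ 2) := by
    field_simp
    ring
  rw [h, abs_div, abs_mul, abs_mul (x - y), abs_of_pos (by positivity : 0 < x ^ 2 * y ^ 2),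
    abs_of_pos (add_pos hx hy), abs_mul α, div_le_div_iff₀ (by positivity) hx]
  have hmin : |α| * |β| ≤ min x y * min x y :=
    mul_le_mul (le_min hαx hαy) (le_min hβx hβy) (abs_nonneg _) (le_min hx.le hy.le)
  have hprod : min x y * max x y = x * y := min_mul_max x y
  have hmax : 0 < max x y := lt_max_of_lt_left hx
  have hmin0 : 0 < min x y := lt_min hx hy
  have hsum : x + y ≤ 2 * max x y := by linarith [le_max_left x y, le_max_right x y]
  calc |α| * |β| * (|x - y| * (x + y)) * x
      ≤ (min x y * min x y) * (L * (2 * max x y)) * max x y := by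
        gcongr
        exact le_max_left x y
    _ = 2 * L * (min x y * max x y) ^ 2 := by ring
    _ = _ := by rw [hprod]; ring

theorem abs_rdot_mul_div_sub_le {a b : Fin 3 → ℝ} {k l : Fin 3 → ℤ} (ha : ∑ i, a i ^ 2 = 1)
    (hb : ∑ i, b i ^ 2 = 1) (hal : rdot a l = 0) (hbl : rdot b l = 0) (hk : k ≠ 0) :
    |rdot a k * rdot b k / znorm (k - l) ^ 2 - rdot a k * rdot b k / znorm k ^ 2| ≤
      2 * znorm l / znorm k := by
  have hka : rdot a (k - l) = rdot a k := by rw [rdot_sub, hal, sub_zero]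
  have hkb : rdot b (k - l) = rdot b k := by rw [rdot_sub, hbl, sub_zero]
  refine abs_div_sq_sub_div_sq_le (one_pos.trans_le (one_le_znorm hk)) (Real.sqrt_nonneg _) ?_
    (abs_rdot_le ha k) (hka ▸ abs_rdot_le ha (k - l)) (abs_rdot_le hb k)
    (hkb ▸ abs_rdot_le hb (k - l))
  have h := abs_norm_sub_norm_le (latticePoint k) (latticePoint (k - l))
  rwa [← latticePoint_sub, sub_sub_cancel, norm_latticePoint, norm_latticePoint,
    norm_latticePoint] at h

theorem one_le_sum_latticeBall_rpow {N : ℕ} (hN : 1 ≤ N) (q : ℝ) :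
    1 ≤ ∑ k ∈ latticeBall N, if k ≠ 0 then znorm k ^ q else 0 := by
  have hmem : Pi.single 0 1 ∈ latticeBall N := by
    rw [mem_latticeBall, znorm_single]
    exact_mod_cast hN
  have h := Finset.single_le_sum (f := fun k : Fin 3 → ℤ => if k ≠ 0 then znorm k ^ q else 0)
    (fun k _ => by
      split_ifs
      · exact Real.rpow_nonneg (Real.sqrt_nonneg _) _
      · exact le_rfl) hmem
  refine le_trans ?_ h
  simp [znorm_single]

theorem tsum_latticeBall (N : ℕ) (q : ℝ) :
    (∑' k : Fin 3 → ℤ, if k ≠ 0 ∧ znorm k ≤ N then znorm k ^ q else 0) =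
      ∑ k ∈ latticeBall N, if k ≠ 0 then znorm k ^ q else 0 := by
  rw [tsum_eq_sum (s := latticeBall N)]
  · refine Finset.sum_congr rfl fun k hk => ?_
    simp [mem_latticeBall.1 hk]
  · intro k hk
    exact if_neg fun h => hk (mem_latticeBall.2 h.2)

theorem sum_latticeBall_truncNorm_rpow (N : ℕ) (q : ℝ) :
    ∑ k ∈ latticeBall N, truncNorm (latticePoint k) ^ q =
      1 + ∑ k ∈ latticeBall N, if k ≠ 0 then znorm k ^ q else 0 := by
  have hmem : 0 ∈ latticeBall N := by
    rw [mem_latticeBall, ← norm_latticePoint, latticePoint_zero, norm_zero]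
    positivity
  have h : ∑ k ∈ latticeBall N, (if k = 0 then (1 : ℝ) else 0) = 1 := by
    rw [Finset.sum_ite_eq', if_pos hmem]
  rw [← h, ← Finset.sum_add_distrib]
  refine Finset.sum_congr rfl fun k _ => ?_
  by_cases hk : k = 0
  · subst hk
    simp [truncNorm_latticePoint_zero]
  · simp [hk, truncNorm_latticePoint hk]

theorem thetaN_sq {γ : ℝ} {N : ℕ} {k : Fin 3 → ℤ} (hk : 1 ≤ znorm k) (hkN : znorm k ≤ N)
    (heps : 0 ≤ epsN 3 γ N) :
    thetaN 3 γ N k ^ 2 = epsN 3 γ N * znorm k ^ (-(2 * γ)) := by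
  rw [thetaN, if_pos ⟨hk, hkN⟩, mul_pow, Real.sq_sqrt heps, ← Real.rpow_mul_natCast (by linarith)]
  congr 2
  push_cast
  ring

/-- 3D:
`|∑_{k ≠ 0, k ≠ l} (θ^N_k)² sin²(∠_{k,l}) (a·(k-l))(b·(k-l))/|k-l|² - (4/15)δ| ≤ C D_N |l|`
uniformly in `N ≥ 1`, `l ∈ ℤ³₀` and unit vectors `a, b ⟂ l` with `a = b` or `a·b = 0`,
where `δ = 1` if `a = b` and `δ = 0` otherwise. -/
theorem stmt16 (γ : ℝ) (hγ : 0 < γ ∧ γ < 3 / 2) :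
    ∃ C : ℝ, 0 < C ∧ ∀ N : ℕ, 1 ≤ N → ∀ l : Fin 3 → ℤ, l ≠ 0 →
      ∀ a b : Fin 3 → ℝ, (∑ i, a i ^ 2 = 1) → (∑ i, b i ^ 2 = 1) →
        rdot a l = 0 → rdot b l = 0 → (a = b ∨ ∑ i, a i * b i = 0) →
        |(∑' k : Fin 3 → ℤ,
            if k ≠ 0 ∧ k ≠ l then
              thetaN 3 γ N k ^ 2 * sin2 k l *
                (rdot a (k - l) * rdot b (k - l) / znorm (k - l) ^ 2)
            else 0) - (if a = b then (4 : ℝ) / 15 else 0)| ≤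
          C * DN 3 γ N * znorm l := by
  classical
  have hp : (0 : ℝ) ≤ 2 * γ := by linarith
  obtain ⟨C, hC, hmain⟩ := exists_abs_sum_weightedQuartic_le hp
  refine ⟨2 * C + 2, by positivity, ?_⟩
  intro N hN l hl a b ha hb hal hbl hab
  set e := (znorm l)⁻¹ • latticePoint l with he
  set c : ℝ := if a = b then 4 / 15 else 0 with hc
  have hl1 := one_le_znorm hl
  have hen : ‖e‖ = 1 := by
    rw [he, norm_smul, norm_latticePoint, norm_inv, Real.norm_eq_abs,
      abs_of_pos (by linarith), inv_mul_cancel₀ (by linarith)]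
  have han : ‖WithLp.toLp 2 a‖ = 1 := by simp [EuclideanSpace.norm_eq, ha]
  have hbn : ‖WithLp.toLp 2 b‖ = 1 := by simp [EuclideanSpace.norm_eq, hb]
  have hea : inner ℝ e (WithLp.toLp 2 a) = 0 := by
    rw [he, real_inner_smul_left, real_inner_comm, inner_toLp_latticePoint, hal, mul_zero]
  have hc1 : |c| ≤ 1 := by
    rw [hc]
    split_ifs <;> norm_num [abs_le]
  have hrad : ∀ w : ℝ → ℝ, Continuous w →
      radialIntegral w N (quartic e (WithLp.toLp 2 a) (WithLp.toLp 2 b) c) = 0 := by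
    intro w hw
    by_cases h : a = b
    · subst h
      rw [hc, if_pos rfl]
      exact radialIntegral_quartic_self hw _ hen han hea
    · rw [hc, if_neg h]
      refine radialIntegral_quartic_of_orthogonal w _ hea ?_
      rw [← hab.resolve_left h]
      simp [PiLp.inner_apply, mul_comm]
  have hQ := hmain N hN e _ _ c hen han hbn hc1 hrad
  set S := ∑ k ∈ latticeBall N, if k ≠ 0 then znorm k ^ (-(2 * γ)) else 0 with hS
  set D := ∑ k ∈ latticeBall N, if k ≠ 0 then znorm k ^ (-(2 * γ) - 1) else 0 with hD
  have hS1 : 1 ≤ S := one_le_sum_latticeBall_rpow hN _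
  have hD1 : 1 ≤ D := one_le_sum_latticeBall_rpow hN _
  have heps : epsN 3 γ N = S⁻¹ := by
    rw [epsN, tsum_latticeBall, neg_mul]
  have hDN : DN 3 γ N = S⁻¹ * D := by
    rw [DN, heps, tsum_latticeBall, neg_mul]
  have htrunc : ∑ k ∈ latticeBall N, truncNorm (latticePoint k) ^ (-(2 * γ) - 1) = 1 + D :=
    sum_latticeBall_truncNorm_rpow N _
  set t : (Fin 3 → ℤ) → ℝ := fun k => if k ≠ 0 ∧ k ≠ l then
    znorm k ^ (-(2 * γ)) * (sin2 k l *
      (rdot a (k - l) * rdot b (k - l) / znorm (k - l) ^ 2)) else 0 with ht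
  have hsum : (∑' k : Fin 3 → ℤ, if k ≠ 0 ∧ k ≠ l then
      thetaN 3 γ N k ^ 2 * sin2 k l * (rdot a (k - l) * rdot b (k - l) / znorm (k - l) ^ 2)
      else 0) = S⁻¹ * ∑ k ∈ latticeBall N, t k := by
    rw [tsum_eq_sum (s := latticeBall N), Finset.mul_sum]
    · refine Finset.sum_congr rfl fun k hk => ?_
      by_cases h : k ≠ 0 ∧ k ≠ l
      · rw [ht, if_pos h]
        simp only [if_pos h]
        rw [thetaN_sq (one_le_znorm h.1) (mem_latticeBall.1 hk) (by
          rw [heps]; exact inv_nonneg.2 (by linarith)), heps]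
        ring
      · rw [ht, if_neg h]
        simp only [if_neg h, mul_zero]
    · intro k hk
      have hθ : thetaN 3 γ N k = 0 := if_neg fun h => hk (mem_latticeBall.2 h.2)
      simp [hθ]
  have hterm : ∀ k ∈ latticeBall N,
      |t k - c * (if k ≠ 0 then znorm k ^ (-(2 * γ)) else 0) -
        weightedQuartic (2 * γ) e (WithLp.toLp 2 a) (WithLp.toLp 2 b) c (latticePoint k)| ≤
      2 * znorm l * (if k ≠ 0 then znorm k ^ (-(2 * γ) - 1) else 0) := by
    intro k _
    by_cases hk : k = 0
    · subst hk
      simp [ht, weightedQuartic_latticePoint_zero]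
    · have hk1 := one_le_znorm hk
      have hk0 : 0 < znorm k := by linarith
      have hpow : 0 ≤ znorm k ^ (-(2 * γ)) := Real.rpow_nonneg hk0.le _
      have htk : t k = znorm k ^ (-(2 * γ)) * (sin2 k l *
          (rdot a k * rdot b k / znorm (k - l) ^ 2)) := by
        have hka : rdot a (k - l) = rdot a k := by rw [rdot_sub, hal, sub_zero]
        have hkb : rdot b (k - l) = rdot b k := by rw [rdot_sub, hbl, sub_zero]
        by_cases h : k = l
        · subst h
          simp [ht, hal]
        · simp only [ht, if_pos (And.intro hk h), hka, hkb]
      rw [htk, if_pos hk, if_pos hk, weightedQuartic_latticePoint hk]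
      have hQk := abs_rdot_mul_div_sub_le ha hb hal hbl hk
      have hs := abs_sin2_le_one hk hl
      have h1 : znorm k ^ (-(2 * γ)) * (sin2 k l * (rdot a k * rdot b k / znorm (k - l) ^ 2)) -
          c * znorm k ^ (-(2 * γ)) - znorm k ^ (-(2 * γ)) *
            (sin2 k l * (rdot a k * rdot b k / znorm k ^ 2) - c) =
          znorm k ^ (-(2 * γ)) * (sin2 k l * (rdot a k * rdot b k / znorm (k - l) ^ 2 -
            rdot a k * rdot b k / znorm k ^ 2)) := by ring
      rw [h1, abs_mul, abs_of_nonneg hpow, abs_mul, Real.rpow_sub_one hk0.ne']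
      calc _ ≤ znorm k ^ (-(2 * γ)) * (1 * (2 * znorm l / znorm k)) := by gcongr
        _ = _ := by ring
  have htot : |(∑ k ∈ latticeBall N, t k) - c * S| ≤ (2 * C + 2) * znorm l * D := by
    have h1 := (Finset.abs_sum_le_sum_abs _ _).trans (Finset.sum_le_sum hterm)
    rw [← Finset.mul_sum, Finset.sum_sub_distrib, Finset.sum_sub_distrib, ← Finset.mul_sum,
      ← hS, ← hD] at h1
    rw [htrunc] at hQ
    have h2 := abs_sub_abs_le_abs_sub ((∑ k ∈ latticeBall N, t k) - c * S)
      (∑ k ∈ latticeBall N,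
        weightedQuartic (2 * γ) e (WithLp.toLp 2 a) (WithLp.toLp 2 b) c (latticePoint k))
    have h3 : C * (1 + D) ≤ C * (2 * D * znorm l) := by
      gcongr
      nlinarith
    linarith
  rw [hsum, hDN]
  have h4 : S⁻¹ * (∑ k ∈ latticeBall N, t k) - c =
      S⁻¹ * ((∑ k ∈ latticeBall N, t k) - c * S) := by
    field_simp
  rw [h4, abs_mul, abs_of_nonneg (inv_nonneg.2 (by linarith))]
  calc _ ≤ S⁻¹ * ((2 * C + 2) * znorm l * D) := by gcongr
    _ = _ := by ring
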